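/- Theorem 1, asymptotic form with explicit constant (relation (3.10)): under the setup below, take λ = 1 and m = ⌈√T⌉. Then for every R > 0 and every choice of coefficient functions (γ_j)_{j=1}^N with Σ_{j=1}^N I_j ≤ R², the VAW iterates w_t ∈ ℝ^{Nm} on the concatenated features satisfy (1/2) E_θ[Σ_{t=1}^T (⟨w_t, Φ_θ(x_t)⟩ − y_t)²] ≤ (1/2) Σ_{t=1}^T (F(x_t) − y_t)² + 4 N (R² + Y² ln(T+1)) √T, where F = Σ_{j=1}^N f_j and T ≥ 1. -/

import Mathlib

open MeasureTheory

/-- The Vovk–Azoury–Warmuth (VAW) iterates with regularization parameter `lam`,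
applied to input vectors `u 1, u 2, …` (indexed by a finite type `ι`) and labels
`y 1, y 2, …`:  `w t = S t ⁻¹ (∑_{i=1}^{t-1} y i • u i)`, where
`S t = lam • I + ∑_{i=1}^{t} (u i) (u i)ᵀ`. -/
noncomputable def vaw {ι : Type*} [Fintype ι] [DecidableEq ι] (lam : ℝ)
    (u : ℕ → ι → ℝ) (y : ℕ → ℝ) (t : ℕ) : ι → ℝ :=
  ((lam • (1 : Matrix ι ι ℝ) + ∑ i ∈ Finset.Icc 1 t, Matrix.vecMulVec (u i) (u i))⁻¹).mulVec
    (∑ i ∈ Finset.Icc 1 (t - 1), y i • u i)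

section LinearAlgebra

open Matrix

variable {ι : Type*} [DecidableEq ι]

/-- The regularized Gram matrix `lam • I + ∑_{i=1}^{t} (u i) (u i)ᵀ`. -/
def vawGram (lam : ℝ) (u : ℕ → ι → ℝ) (t : ℕ) : Matrix ι ι ℝ :=
  lam • (1 : Matrix ι ι ℝ) + ∑ i ∈ Finset.Icc 1 t, vecMulVec (u i) (u i)

theorem vawGram_succ (lam : ℝ) (u : ℕ → ι → ℝ) (t : ℕ) :
    vawGram lam u (t + 1) = vawGram lam u t + vecMulVec (u (t + 1)) (u (t + 1)) := by
  rw [vawGram, Finset.sum_Icc_succ_top (by lia), ← add_assoc, vawGram]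

variable [Fintype ι]

/-- The variational lower bound `2⟨b, v⟩ - ⟨v, A v⟩ ≤ ⟨b, A⁻¹ b⟩`. -/
theorem Matrix.PosDef.two_mul_dotProduct_sub_le {A : Matrix ι ι ℝ} (hA : A.PosDef) (b v : ι → ℝ) :
    2 * (b ⬝ᵥ v) - v ⬝ᵥ A *ᵥ v ≤ b ⬝ᵥ A⁻¹ *ᵥ b := by
  have hu : IsUnit A.det := (Matrix.isUnit_iff_isUnit_det A).1 hA.isUnit
  have hAb : A *ᵥ (A⁻¹ *ᵥ b) = b := by
    rw [mulVec_mulVec, mul_nonsing_inv _ hu, one_mulVec]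
  have hT : Aᵀ = A := by simpa using hA.isHermitian.eq
  have hsymm : (A⁻¹ *ᵥ b) ⬝ᵥ A *ᵥ v = b ⬝ᵥ v := by
    rw [dotProduct_mulVec, ← mulVec_transpose, hT, hAb]
  have h := hA.posSemidef.dotProduct_mulVec_nonneg (v - A⁻¹ *ᵥ b)
  rw [star_trivial, mulVec_sub, hAb, dotProduct_sub, sub_dotProduct, sub_dotProduct, hsymm,
    dotProduct_comm v b, dotProduct_comm (A⁻¹ *ᵥ b) b] at h
  linarith

theorem Matrix.det_eq_det_add_vecMulVec_mul {A : Matrix ι ι ℝ} (u : ι → ℝ)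
    (h : IsUnit (A + vecMulVec u u).det) :
    A.det = (A + vecMulVec u u).det * (1 - u ⬝ᵥ (A + vecMulVec u u)⁻¹ *ᵥ u) := by
  set B := A + vecMulVec u u with hB
  have hdet := det_one_add_replicateCol_mul_replicateRow (ι := Unit) (-(B⁻¹ *ᵥ u)) u
  rw [← vecMulVec_eq, neg_vecMulVec, ← sub_eq_add_neg, dotProduct_neg, ← sub_eq_add_neg] at hdet
  rw [← hdet, ← det_mul, mul_sub, mul_one, mul_vecMulVec, mulVec_mulVec, mul_nonsing_inv _ h,
    one_mulVec, hB, add_sub_cancel_right]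

theorem Matrix.PosDef.add_vecMulVec_self {κ : Type*} [Fintype κ] {A : Matrix κ κ ℝ}
    (hA : A.PosDef) (u : κ → ℝ) :
    (A + vecMulVec u u).PosDef :=
  hA.add_posSemidef (by simpa using posSemidef_vecMulVec_self_star u)

theorem Matrix.PosDef.dotProduct_inv_mulVec_le_log_det {A : Matrix ι ι ℝ} (hA : A.PosDef)
    (u : ι → ℝ) :
    u ⬝ᵥ (A + vecMulVec u u)⁻¹ *ᵥ u ≤ Real.log (A + vecMulVec u u).det - Real.log A.det := by
  have hB := hA.add_vecMulVec_self u
  have hdet := det_eq_det_add_vecMulVec_mul u hB.det_pos.ne'.isUnit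
  have hpos : 0 < 1 - u ⬝ᵥ (A + vecMulVec u u)⁻¹ *ᵥ u :=
    pos_of_mul_pos_right (hdet ▸ hA.det_pos) hB.det_pos.le
  have hlog := Real.log_le_sub_one_of_pos hpos
  rw [hdet, Real.log_mul hB.det_pos.ne' hpos.ne']
  linarith

theorem Matrix.PosDef.log_det_le {A : Matrix ι ι ℝ} (hA : A.PosDef) {c : ℝ} (hc : 0 < c)
    (htr : A.trace ≤ Fintype.card ι * c) : Real.log A.det ≤ Fintype.card ι * Real.log c := by
  have hpos := hA.eigenvalues_pos
  have hdet : A.det = ∏ i, hA.isHermitian.eigenvalues i := by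
    simpa using hA.isHermitian.det_eq_prod_eigenvalues
  have htrace : A.trace = ∑ i, hA.isHermitian.eigenvalues i := by
    simpa using hA.isHermitian.trace_eq_sum_eigenvalues
  have hle : ∀ i, Real.log (hA.isHermitian.eigenvalues i)
      ≤ Real.log c + (hA.isHermitian.eigenvalues i / c - 1) := fun i => by
    have := Real.log_le_sub_one_of_pos (div_pos (hpos i) hc)
    rw [Real.log_div (hpos i).ne' hc.ne'] at this
    linarith
  rw [hdet, Real.log_prod fun i _ => (hpos i).ne']
  refine (Finset.sum_le_sum fun i _ => hle i).trans ?_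
  have hdiv : A.trace / c ≤ Fintype.card ι := (div_le_iff₀ hc).2 htr
  rw [Finset.sum_add_distrib, Finset.sum_sub_distrib, ← Finset.sum_div, ← htrace]
  simp only [Finset.sum_const, Finset.card_univ, nsmul_eq_mul]
  linarith

theorem vawGram_posDef {lam : ℝ} (hlam : 0 < lam) (u : ℕ → ι → ℝ) (t : ℕ) :
    (vawGram lam u t).PosDef := by
  induction t with
  | zero => simpa [vawGram] using PosDef.one.smul hlam
  | succ t ih => rw [vawGram_succ]; exact ih.add_vecMulVec_self _

theorem dotProduct_vawGram_mulVec (lam : ℝ) (u : ℕ → ι → ℝ) (t : ℕ) (w : ι → ℝ) :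
    w ⬝ᵥ vawGram lam u t *ᵥ w = lam * (w ⬝ᵥ w) + ∑ i ∈ Finset.Icc 1 t, (w ⬝ᵥ u i) ^ 2 := by
  simp [vawGram, add_mulVec, sum_mulVec, sum_dotProduct, smul_mulVec, vecMulVec_mulVec, sq,
    dotProduct_comm w]

theorem trace_vawGram (lam : ℝ) (u : ℕ → ι → ℝ) (t : ℕ) :
    (vawGram lam u t).trace = Fintype.card ι * lam + ∑ i ∈ Finset.Icc 1 t, u i ⬝ᵥ u i := by
  simp [vawGram, trace_add, trace_sum, trace_vecMulVec, mul_comm]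

theorem log_det_vawGram_one_le {u : ℕ → ι → ℝ} {t : ℕ} {c : ℝ} (hc : 0 ≤ c)
    (hu : ∀ s i, u s i ^ 2 ≤ c) :
    Real.log (vawGram 1 u t).det ≤ Fintype.card ι * Real.log (1 + c * t) := by
  refine (vawGram_posDef one_pos u t).log_det_le (by positivity) ?_
  have hle : ∀ s ∈ Finset.Icc 1 t, u s ⬝ᵥ u s ≤ Fintype.card ι * c := fun s _ => by
    refine (Finset.sum_le_card_nsmul Finset.univ _ c fun i _ => ?_).trans_eq (by simp)
    rw [← sq]
    exact hu s i
  have hsum := Finset.sum_le_card_nsmul _ _ _ hle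
  rw [Nat.card_Icc, Nat.add_sub_cancel, nsmul_eq_mul] at hsum
  rw [trace_vawGram]
  linarith

theorem vaw_succ (lam : ℝ) (u : ℕ → ι → ℝ) (y : ℕ → ℝ) (t : ℕ) :
    vaw lam u y (t + 1)
      = (vawGram lam u (t + 1))⁻¹ *ᵥ ∑ i ∈ Finset.Icc 1 t, y i • u i := rfl

theorem sq_vaw_sub_le {lam : ℝ} (hlam : 0 < lam) (u : ℕ → ι → ℝ) (y : ℕ → ℝ) (t : ℕ) :
    (vaw lam u y (t + 1) ⬝ᵥ u (t + 1) - y (t + 1)) ^ 2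
      ≤ y (t + 1) ^ 2
        + (∑ i ∈ Finset.Icc 1 t, y i • u i) ⬝ᵥ
          (vawGram lam u t)⁻¹ *ᵥ (∑ i ∈ Finset.Icc 1 t, y i • u i)
        - (∑ i ∈ Finset.Icc 1 (t + 1), y i • u i) ⬝ᵥ
          (vawGram lam u (t + 1))⁻¹ *ᵥ (∑ i ∈ Finset.Icc 1 (t + 1), y i • u i)
        + y (t + 1) ^ 2 * (u (t + 1) ⬝ᵥ (vawGram lam u (t + 1))⁻¹ *ᵥ u (t + 1)) := by
  rw [Finset.sum_Icc_succ_top (by lia), vaw_succ]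
  set b := ∑ i ∈ Finset.Icc 1 t, y i • u i
  set A := vawGram lam u t
  set B := vawGram lam u (t + 1) with hB
  set v := u (t + 1)
  set z := y (t + 1)
  have hBpos : B.PosDef := vawGram_posDef hlam u (t + 1)
  have hBA : B = A + vecMulVec v v := vawGram_succ lam u t
  have hT : B⁻¹ᵀ = B⁻¹ := by simpa using hBpos.inv.isHermitian.eq
  have hBb : B *ᵥ (B⁻¹ *ᵥ b) = b := by
    rw [mulVec_mulVec, mul_nonsing_inv _ hBpos.det_pos.ne'.isUnit, one_mulVec]
  have hsymm : b ⬝ᵥ B⁻¹ *ᵥ v = (B⁻¹ *ᵥ b) ⬝ᵥ v := by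
    rw [dotProduct_mulVec, ← mulVec_transpose, hT]
  have hvar := (vawGram_posDef hlam u t).two_mul_dotProduct_sub_le b (B⁻¹ *ᵥ b)
  have hquad : (B⁻¹ *ᵥ b) ⬝ᵥ A *ᵥ (B⁻¹ *ᵥ b) = b ⬝ᵥ B⁻¹ *ᵥ b - ((B⁻¹ *ᵥ b) ⬝ᵥ v) ^ 2 := by
    have hA : A = B - vecMulVec v v := by rw [hBA, add_sub_cancel_right]
    rw [hA, sub_mulVec, hBb, dotProduct_sub, dotProduct_comm _ b, vecMulVec_mulVec]
    simp [sq, dotProduct_comm v]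
  change 2 * _ - (B⁻¹ *ᵥ b) ⬝ᵥ A *ᵥ (B⁻¹ *ᵥ b) ≤ b ⬝ᵥ A⁻¹ *ᵥ b at hvar
  rw [hquad] at hvar
  rw [mulVec_add, mulVec_smul, add_dotProduct, dotProduct_add, dotProduct_add, smul_dotProduct,
    smul_dotProduct, dotProduct_smul, dotProduct_smul, hsymm, dotProduct_comm v (B⁻¹ *ᵥ b)]
  simp only [smul_eq_mul]
  nlinarith [hvar]

theorem sum_sq_vaw_sub_le {lam : ℝ} (hlam : 0 < lam) {Y : ℝ} (u : ℕ → ι → ℝ) (y : ℕ → ℝ)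
    (T : ℕ) (hy : ∀ t ∈ Finset.Icc 1 T, |y t| ≤ Y) :
    ∑ t ∈ Finset.Icc 1 T, (vaw lam u y t ⬝ᵥ u t - y t) ^ 2
      ≤ ∑ t ∈ Finset.Icc 1 T, y t ^ 2
        - (∑ i ∈ Finset.Icc 1 T, y i • u i) ⬝ᵥ
          (vawGram lam u T)⁻¹ *ᵥ (∑ i ∈ Finset.Icc 1 T, y i • u i)
        + Y ^ 2 * (Real.log (vawGram lam u T).det - Real.log (vawGram lam u 0).det) := by
  induction T with
  | zero => simp
  | succ T ih =>
    have ih' := ih fun t ht => hy t (Finset.Icc_subset_Icc_right (Nat.le_succ T) ht)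
    have hstep := sq_vaw_sub_le hlam u y T
    rw [Finset.sum_Icc_succ_top (by lia), Finset.sum_Icc_succ_top (by lia) fun t => y t ^ 2]
    have hysq : y (T + 1) ^ 2 ≤ Y ^ 2 :=
      sq_le_sq' (abs_le.1 (hy _ (by simp))).1 (abs_le.1 (hy _ (by simp))).2
    have hnonneg := (vawGram_posDef hlam u (T + 1)).inv.posSemidef.dotProduct_mulVec_nonneg
      (u (T + 1))
    rw [star_trivial] at hnonneg
    have hlog := (vawGram_posDef hlam u T).dotProduct_inv_mulVec_le_log_det (u (T + 1))
    rw [← vawGram_succ] at hlog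
    have hprod := mul_le_mul hysq hlog hnonneg (sq_nonneg Y)
    linarith

/-- The logarithmic regret bound for the VAW forecaster against a fixed linear predictor. -/
theorem vaw_regret {lam : ℝ} (hlam : 0 < lam) {Y : ℝ} (u : ℕ → ι → ℝ) (y : ℕ → ℝ)
    (T : ℕ) (hy : ∀ t ∈ Finset.Icc 1 T, |y t| ≤ Y) (w : ι → ℝ) :
    ∑ t ∈ Finset.Icc 1 T, (vaw lam u y t ⬝ᵥ u t - y t) ^ 2
      ≤ ∑ t ∈ Finset.Icc 1 T, (w ⬝ᵥ u t - y t) ^ 2 + lam * (w ⬝ᵥ w)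
        + Y ^ 2 * (Real.log (vawGram lam u T).det - Real.log (vawGram lam u 0).det) := by
  have hsum := sum_sq_vaw_sub_le hlam u y T hy
  have hvar := (vawGram_posDef hlam u T).two_mul_dotProduct_sub_le
    (∑ i ∈ Finset.Icc 1 T, y i • u i) w
  rw [dotProduct_vawGram_mulVec, sum_dotProduct] at hvar
  have hexp : ∑ t ∈ Finset.Icc 1 T, (w ⬝ᵥ u t - y t) ^ 2
      = ∑ t ∈ Finset.Icc 1 T, (w ⬝ᵥ u t) ^ 2 - 2 * ∑ t ∈ Finset.Icc 1 T, (y t • u t) ⬝ᵥ w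
        + ∑ t ∈ Finset.Icc 1 T, y t ^ 2 := by
    rw [Finset.mul_sum, ← Finset.sum_sub_distrib, ← Finset.sum_add_distrib]
    refine Finset.sum_congr rfl fun t _ => ?_
    rw [smul_dotProduct, smul_eq_mul, dotProduct_comm (u t)]
    ring
  linarith

/-- The VAW regret bound with unit regularization and uniformly bounded features. -/
theorem vaw_one_regret_of_sq_le {Y c : ℝ} {u : ℕ → ι → ℝ} (hc : 0 ≤ c)
    (hu : ∀ s i, u s i ^ 2 ≤ c) (y : ℕ → ℝ) (T : ℕ) (hy : ∀ t ∈ Finset.Icc 1 T, |y t| ≤ Y)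
    (w : ι → ℝ) :
    ∑ t ∈ Finset.Icc 1 T, (∑ i, vaw 1 u y t i * u t i - y t) ^ 2
      ≤ ∑ t ∈ Finset.Icc 1 T, (∑ i, w i * u t i - y t) ^ 2 + ∑ i, w i ^ 2
        + Y ^ 2 * (Fintype.card ι * Real.log (1 + c * T)) := by
  have hreg := vaw_regret one_pos u y T hy w
  have hdet := mul_le_mul_of_nonneg_left (log_det_vawGram_one_le (t := T) hc hu) (sq_nonneg Y)
  have hzero : Real.log (vawGram 1 u 0).det = 0 := by simp [vawGram]
  rw [hzero, sub_zero, one_mul] at hreg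
  simp only [dotProduct, ← sq] at hreg
  linarith

end LinearAlgebra

section Probability

open ProbabilityTheory

variable {ι κ : Type*} [Fintype ι] [Fintype κ] {Ω : ι → Type*} [∀ i, MeasurableSpace (Ω i)]
  {ν : ∀ i, Measure (Ω i)} [∀ i, IsProbabilityMeasure (ν i)]

theorem measurePreserving_eval_eval (ν : ∀ i, Measure (Ω i)) [∀ i, IsProbabilityMeasure (ν i)]
    (i : ι) (k : κ) :
    MeasurePreserving (fun ω : ∀ i, κ → Ω i => ω i k)
      (Measure.pi fun i => Measure.pi fun _ : κ => ν i) (ν i) :=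
  (measurePreserving_eval (fun _ : κ => ν i) k).comp
    (measurePreserving_eval (fun i => Measure.pi fun _ : κ => ν i) i)

theorem integrable_sum_eval_eval {g : ∀ i, Ω i → ℝ} (hg : ∀ i, Integrable (g i) (ν i)) :
    Integrable (fun ω : ∀ i, κ → Ω i => ∑ ik : ι × κ, g ik.1 (ω ik.1 ik.2))
      (Measure.pi fun i => Measure.pi fun _ : κ => ν i) :=
  integrable_finsetSum _ fun ik _ =>
    (measurePreserving_eval_eval ν ik.1 ik.2).integrable_comp_of_integrable (hg ik.1)

theorem memLp_sum_eval_eval {g : ∀ i, Ω i → ℝ} (hg : ∀ i, MemLp (g i) 2 (ν i)) :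
    MemLp (fun ω : ∀ i, κ → Ω i => ∑ ik : ι × κ, g ik.1 (ω ik.1 ik.2)) 2
      (Measure.pi fun i => Measure.pi fun _ : κ => ν i) :=
  memLp_finsetSum _ fun ik _ =>
    (hg ik.1).comp_measurePreserving (measurePreserving_eval_eval ν ik.1 ik.2)

theorem integral_sum_eval_eval {g : ∀ i, Ω i → ℝ} (hg : ∀ i, Integrable (g i) (ν i)) :
    ∫ ω : ∀ i, κ → Ω i, ∑ ik : ι × κ, g ik.1 (ω ik.1 ik.2)
      ∂(Measure.pi fun i => Measure.pi fun _ : κ => ν i)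
      = Fintype.card κ * ∑ i, ∫ θ, g i θ ∂(ν i) := by
  have hinteg : ∀ ik : ι × κ, ∫ ω : ∀ i, κ → Ω i, g ik.1 (ω ik.1 ik.2)
      ∂(Measure.pi fun i => Measure.pi fun _ : κ => ν i) = ∫ θ, g ik.1 θ ∂(ν ik.1) := fun ik => by
    have hmp := measurePreserving_eval_eval (κ := κ) ν ik.1 ik.2
    rw [← hmp.map_eq, integral_map hmp.measurable.aemeasurable]
    rw [hmp.map_eq]
    exact (hg ik.1).aestronglyMeasurable
  rw [integral_finsetSum _ fun ik _ =>
    (measurePreserving_eval_eval ν ik.1 ik.2).integrable_comp_of_integrable (hg ik.1),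
    Finset.sum_congr rfl fun ik _ => hinteg ik, Fintype.sum_prod_type, Finset.mul_sum]
  refine Finset.sum_congr rfl fun i _ => ?_
  change ∑ _ : κ, ∫ θ, g i θ ∂(ν i) = _
  rw [Finset.sum_const, Finset.card_univ, nsmul_eq_mul]

theorem variance_sum_eval_eval {g : ∀ i, Ω i → ℝ} (hg : ∀ i, MemLp (g i) 2 (ν i)) :
    Var[fun ω : ∀ i, κ → Ω i => ∑ ik : ι × κ, g ik.1 (ω ik.1 ik.2);
      Measure.pi fun i => Measure.pi fun _ : κ => ν i]
      = Fintype.card κ * ∑ i, Var[g i; ν i] := by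
  have hinner : ∀ i, MemLp (∑ k, fun ω : κ → Ω i => g i (ω k)) 2 (Measure.pi fun _ => ν i) :=
    fun i => memLp_finsetSum' _ fun k _ =>
      (hg i).comp_measurePreserving (measurePreserving_eval (fun _ : κ => ν i) k)
  have hvar := variance_sum_pi hinner
  simp only [fun i => variance_sum_pi (ι := κ) (μ := fun _ => ν i) (X := fun _ => g i)
    fun _ => hg i, Finset.sum_const, Finset.card_univ, nsmul_eq_mul, ← Finset.mul_sum] at hvar
  rw [← hvar]
  congr 1
  ext ω
  simp [Fintype.sum_prod_type]

/-- Bias-variance bound for a sum of independent samples. -/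
theorem integral_sq_sum_eval_eval_sub_le {g : ∀ i, Ω i → ℝ} (hg : ∀ i, MemLp (g i) 2 (ν i))
    (c : ℝ) :
    ∫ ω : ∀ i, κ → Ω i, (∑ ik : ι × κ, g ik.1 (ω ik.1 ik.2) - c) ^ 2
      ∂(Measure.pi fun i => Measure.pi fun _ : κ => ν i)
      ≤ (Fintype.card κ * ∑ i, ∫ θ, g i θ ∂(ν i) - c) ^ 2
        + Fintype.card κ * ∑ i, ∫ θ, g i θ ^ 2 ∂(ν i) := by
  have hG := memLp_sum_eval_eval (κ := κ) hg
  have hvar := variance_eq_sub (hG.sub (memLp_const c))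
  have hvarc := variance_sub_const hG.aestronglyMeasurable c
  have hmean := integral_sum_eval_eval (κ := κ) fun i => (hg i).integrable one_le_two
  have hle : ∑ i, Var[g i; ν i] ≤ ∑ i, ∫ θ, g i θ ^ 2 ∂(ν i) :=
    Finset.sum_le_sum fun i _ => variance_le_expectation_sq (hg i).aestronglyMeasurable
  have hle' := mul_le_mul_of_nonneg_left hle (Nat.cast_nonneg (α := ℝ) (Fintype.card κ))
  rw [← variance_sum_eval_eval hg, ← hvarc] at hle'
  simp only [Pi.sub_def, Pi.pow_apply] at hvar
  rw [integral_sub (hG.integrable one_le_two) (integrable_const c), hmean] at hvar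
  simp only [integral_const, probReal_univ, one_smul] at hvar
  change _ = _ - (_ - c) ^ 2 at hvar
  linarith


variable {α : Type*} [MeasurableSpace α] {μ : Measure α} {p γ φ : α → ℝ}

theorem integral_withDensity_ofReal (hp : Measurable p) (hp0 : 0 ≤ p) (g : α → ℝ) :
    ∫ θ, g θ ∂(μ.withDensity fun θ => ENNReal.ofReal (p θ)) = ∫ θ, p θ * g θ ∂μ := by
  rw [integral_withDensity_eq_integral_toReal_smul hp.ennreal_ofReal
    (Filter.Eventually.of_forall fun _ => ENNReal.ofReal_lt_top)]
  simp [ENNReal.toReal_ofReal (hp0 _)]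

theorem integral_sq_div_withDensity_ofReal (hp : Measurable p) (hp0 : 0 ≤ p) :
    ∫ θ, (γ θ / p θ) ^ 2 ∂(μ.withDensity fun θ => ENNReal.ofReal (p θ))
      = ∫ θ, γ θ ^ 2 / p θ ∂μ := by
  rw [integral_withDensity_ofReal hp hp0]
  refine integral_congr_ae (Filter.Eventually.of_forall fun θ => ?_)
  rcases eq_or_ne (p θ) 0 with h | h
  · simp [h]
  · field_simp

theorem memLp_div_withDensity_ofReal (hp : Measurable p) (hp0 : 0 ≤ p) (hγ : Measurable γ)
    (hI : Integrable (fun θ => γ θ ^ 2 / p θ) μ) :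
    MemLp (fun θ => γ θ / p θ) 2 (μ.withDensity fun θ => ENNReal.ofReal (p θ)) := by
  have hmeas : Measurable fun θ => γ θ / p θ := hγ.div hp
  rw [memLp_two_iff_integrable_sq hmeas.aestronglyMeasurable,
    integrable_withDensity_iff hp.ennreal_ofReal
      (Filter.Eventually.of_forall fun _ => ENNReal.ofReal_lt_top)]
  refine hI.congr (Filter.Eventually.of_forall fun θ => ?_)
  simp only [ENNReal.toReal_ofReal (hp0 θ)]
  rcases eq_or_ne (p θ) 0 with h | h
  · simp [h]
  · field_simp

theorem integral_div_mul_withDensity_ofReal (hp : Measurable p) (hp0 : 0 ≤ p)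
    (hpos : ∀ᵐ θ ∂μ, 0 < p θ) :
    ∫ θ, γ θ / p θ * φ θ ∂(μ.withDensity fun θ => ENNReal.ofReal (p θ))
      = ∫ θ, γ θ * φ θ ∂μ := by
  rw [integral_withDensity_ofReal hp hp0]
  refine integral_congr_ae ?_
  filter_upwards [hpos] with θ h
  field_simp

/-- Multiplying by a bounded function preserves square integrability and scales the second
moment by at most the square of the bound. -/
theorem MeasureTheory.MemLp.mul_bounded_two {q : α → ℝ} (hq : MemLp q 2 μ) {c : ℝ}
    (hφ : Measurable φ) (hc : ∀ θ, |φ θ| ≤ c) :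
    MemLp (fun θ => q θ * φ θ) 2 μ ∧ ∫ θ, (q θ * φ θ) ^ 2 ∂μ ≤ c ^ 2 * ∫ θ, q θ ^ 2 ∂μ := by
  have hmem : MemLp (fun θ => q θ * φ θ) 2 μ :=
    hq.of_le_mul (c := c) (hq.aestronglyMeasurable.mul hφ.aestronglyMeasurable) <|
      Filter.Eventually.of_forall fun θ => by
        rw [norm_mul, mul_comm]
        exact mul_le_mul_of_nonneg_right (hc θ) (norm_nonneg _)
  refine ⟨hmem, ?_⟩
  rw [← integral_const_mul]
  refine integral_mono hmem.integrable_sq (hq.integrable_sq.const_mul _) fun θ => ?_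
  have : φ θ ^ 2 ≤ c ^ 2 := sq_le_sq' (abs_le.1 (hc θ)).1 (abs_le.1 (hc θ)).2
  simp only [mul_pow]
  nlinarith [mul_le_mul_of_nonneg_left this (sq_nonneg (q θ))]

/-- Importance-weighted random features: the expected loss of the predictor with weights
`q i (ω i k) / m`, plus its expected squared weight norm, exceeds the loss of the mean predictor by
at most the Monte Carlo error. -/
theorem integral_random_feature_loss_le [Nonempty κ] {τ : Type*} (s : Finset τ)
    {q : ∀ i, Ω i → ℝ} (hq : ∀ i, MemLp (q i) 2 (ν i)) {ψ : τ → ∀ i, Ω i → ℝ}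
    (hψ : ∀ t i, Measurable (ψ t i)) {c : ℝ} (hc : ∀ t i θ, |ψ t i θ| ≤ c) (y : τ → ℝ) :
    Integrable (fun ω : ∀ i, κ → Ω i =>
        ∑ t ∈ s, (∑ ik : ι × κ, q ik.1 (ω ik.1 ik.2) / Fintype.card κ
          * ψ t ik.1 (ω ik.1 ik.2) - y t) ^ 2
        + ∑ ik : ι × κ, (q ik.1 (ω ik.1 ik.2) / Fintype.card κ) ^ 2)
      (Measure.pi fun i => Measure.pi fun _ : κ => ν i) ∧
    ∫ ω : ∀ i, κ → Ω i,
        (∑ t ∈ s, (∑ ik : ι × κ, q ik.1 (ω ik.1 ik.2) / Fintype.card κ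
          * ψ t ik.1 (ω ik.1 ik.2) - y t) ^ 2
        + ∑ ik : ι × κ, (q ik.1 (ω ik.1 ik.2) / Fintype.card κ) ^ 2)
      ∂(Measure.pi fun i => Measure.pi fun _ : κ => ν i)
    ≤ ∑ t ∈ s, (∑ i, ∫ θ, q i θ * ψ t i θ ∂(ν i) - y t) ^ 2
      + (s.card * c ^ 2 + 1) * (∑ i, ∫ θ, q i θ ^ 2 ∂(ν i)) / Fintype.card κ := by
  have hm : (Fintype.card κ : ℝ) ≠ 0 := by positivity
  set m : ℝ := (Fintype.card κ : ℝ)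
  have hqm : ∀ i, MemLp (fun θ => q i θ / m) 2 (ν i) := fun i => by
    simpa only [div_eq_mul_inv] using (hq i).mul_const m⁻¹
  have hg := fun t i => (hqm i).mul_bounded_two (hψ t i) (hc t i)
  have hqint : ∀ i, ∫ θ, (q i θ / m) ^ 2 ∂(ν i) = (∫ θ, q i θ ^ 2 ∂(ν i)) / m ^ 2 := fun i => by
    simp only [div_pow, integral_div]
  have hloss : ∀ t, Integrable (fun ω : ∀ i, κ → Ω i =>
      (∑ ik : ι × κ, q ik.1 (ω ik.1 ik.2) / m * ψ t ik.1 (ω ik.1 ik.2) - y t) ^ 2)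
      (Measure.pi fun i => Measure.pi fun _ : κ => ν i) := fun t =>
    ((memLp_sum_eval_eval fun i => (hg t i).1).sub (memLp_const (y t))).integrable_sq
  have hnorm := integrable_sum_eval_eval (κ := κ) fun i => (hqm i).integrable_sq
  refine ⟨(integrable_finsetSum _ fun t _ => hloss t).add hnorm, ?_⟩
  rw [integral_add (integrable_finsetSum _ fun t _ => hloss t) hnorm,
    integral_finsetSum _ fun t _ => hloss t,
    integral_sum_eval_eval fun i => (hqm i).integrable_sq]
  simp only [hqint, ← Finset.sum_div]
  have hterm : ∀ t ∈ s, ∫ ω : ∀ i, κ → Ω i,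
      (∑ ik : ι × κ, q ik.1 (ω ik.1 ik.2) / m * ψ t ik.1 (ω ik.1 ik.2) - y t) ^ 2
      ∂(Measure.pi fun i => Measure.pi fun _ : κ => ν i)
      ≤ (∑ i, ∫ θ, q i θ * ψ t i θ ∂(ν i) - y t) ^ 2
        + c ^ 2 * (∑ i, ∫ θ, q i θ ^ 2 ∂(ν i)) / m := fun t _ => by
    refine (integral_sq_sum_eval_eval_sub_le (fun i => (hg t i).1) (y t)).trans ?_
    have hmean : ∀ i, ∫ θ, q i θ / m * ψ t i θ ∂(ν i) = (∫ θ, q i θ * ψ t i θ ∂(ν i)) / m :=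
      fun i => by simp only [div_mul_eq_mul_div, integral_div]
    have hsq := Finset.sum_le_sum fun i (_ : i ∈ Finset.univ) => (hg t i).2
    rw [← Finset.mul_sum] at hsq
    simp only [hqint, ← Finset.sum_div] at hsq
    simp only [hmean, ← Finset.sum_div]
    rw [mul_div_cancel₀ _ hm]
    have hsq' := mul_le_mul_of_nonneg_left hsq (Nat.cast_nonneg (α := ℝ) (Fintype.card κ))
    refine add_le_add_right (hsq'.trans_eq ?_) _
    change m * _ = _
    field_simp
  refine (add_le_add_left (Finset.sum_le_sum hterm) _).trans_eq ?_
  rw [Finset.sum_add_distrib, Finset.sum_const, nsmul_eq_mul]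
  field_simp
  ring

/-- Expected loss of the VAW forecaster on concatenated random features. -/
theorem integral_vaw_loss_le [Nonempty κ] [DecidableEq ι] [DecidableEq κ]
    {q : ∀ i, Ω i → ℝ} (hq : ∀ i, MemLp (q i) 2 (ν i)) {ψ : ℕ → ∀ i, Ω i → ℝ}
    (hψ : ∀ t i, Measurable (ψ t i)) {c : ℝ} (hc : ∀ t i θ, |ψ t i θ| ≤ c) {Y : ℝ} (y : ℕ → ℝ)
    (T : ℕ) (hy : ∀ t ∈ Finset.Icc 1 T, |y t| ≤ Y) :
    ∫ ω : ∀ i, κ → Ω i,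
        ∑ t ∈ Finset.Icc 1 T, (∑ ik : ι × κ,
          vaw 1 (fun s ik' => ψ s ik'.1 (ω ik'.1 ik'.2)) y t ik * ψ t ik.1 (ω ik.1 ik.2) - y t) ^ 2
      ∂(Measure.pi fun i => Measure.pi fun _ : κ => ν i)
    ≤ ∑ t ∈ Finset.Icc 1 T, (∑ i, ∫ θ, q i θ * ψ t i θ ∂(ν i) - y t) ^ 2
      + (T * c ^ 2 + 1) * (∑ i, ∫ θ, q i θ ^ 2 ∂(ν i)) / Fintype.card κ
      + Y ^ 2 * (Fintype.card ι * Fintype.card κ * Real.log (1 + c ^ 2 * T)) := by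
  obtain ⟨hinteg, hle⟩ := integral_random_feature_loss_le (κ := κ) (Finset.Icc 1 T) hq hψ hc y
  rw [Nat.card_Icc, Nat.add_sub_cancel] at hle
  refine (integral_mono_of_nonneg
    (Filter.Eventually.of_forall fun ω => Finset.sum_nonneg fun t _ => sq_nonneg _)
    (hinteg.add (integrable_const
      (Y ^ 2 * (Fintype.card ι * Fintype.card κ * Real.log (1 + c ^ 2 * T)))))
    (Filter.Eventually.of_forall fun ω => ?_)).trans ?_
  · have hreg := vaw_one_regret_of_sq_le (c := c ^ 2)
      (u := fun s (ik : ι × κ) => ψ s ik.1 (ω ik.1 ik.2)) (sq_nonneg c)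
      (fun s ik => sq_le_sq' (abs_le.1 (hc _ _ _)).1 (abs_le.1 (hc _ _ _)).2) y T hy
      fun ik => q ik.1 (ω ik.1 ik.2) / Fintype.card κ
    rw [Fintype.card_prod, Nat.cast_mul] at hreg
    exact hreg
  · simp only [Pi.add_apply]
    rw [integral_add hinteg (integrable_const _), integral_const, probReal_univ, one_smul]
    exact add_le_add_left hle _

end Probability

theorem Nat.ceil_sqrt_bounds {T : ℕ} (hT : 1 ≤ T) :
    √T ≤ (⌈√T⌉₊ : ℝ) ∧ (⌈√T⌉₊ : ℝ) ≤ 2 * √T := by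
  have hone : 1 ≤ √(T : ℝ) := Real.one_le_sqrt.2 (by exact_mod_cast hT)
  have := Nat.ceil_lt_add_one (Real.sqrt_nonneg (T : ℝ))
  exact ⟨Nat.le_ceil _, by linarith⟩

theorem Real.log_one_add_two_mul_le {t : ℝ} (ht : 0 ≤ t) :
    Real.log (1 + 2 * t) ≤ 2 * Real.log (t + 1) := by
  rw [← Real.log_rpow (by positivity)]
  refine Real.log_le_log (by positivity) ?_
  norm_num
  nlinarith [sq_nonneg t]

/-- **Theorem 1, asymptotic form with explicit constant (relation (3.10)).**
Same multi-kernel random feature setup as Theorem 1, with `λ = 1` and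
`m = ⌈√T⌉`.  For every `R > 0` and coefficient functions `(γⱼ)` with
`∑ⱼ Iⱼ ≤ R²`, the VAW iterates on the concatenated features satisfy
`(1/2) E_θ[∑ₜ (⟨w_t, Φ_θ(x_t)⟩ − y_t)²]
  ≤ (1/2) ∑ₜ (F(x_t) − y_t)² + 4N(R² + Y² ln(T+1))√T`, where `F = ∑ⱼ fⱼ`. -/
theorem vaw_concatenated_random_features_asymptotic_bound
    (d N m T : ℕ) (hT : 1 ≤ T) (hm : m = ⌈Real.sqrt T⌉₊)
    (Y R : ℝ) (hY : 0 < Y) (hR : 0 < R)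
    (Θ : Fin N → Type*) [∀ j, MeasurableSpace (Θ j)]
    (μ : ∀ j, Measure (Θ j)) [∀ j, SigmaFinite (μ j)]
    (p : ∀ j, Θ j → ℝ) (hp_meas : ∀ j, Measurable (p j))
    (hp_nonneg : ∀ j θ, 0 ≤ p j θ)
    (hp_prob : ∀ j, ∫⁻ θ, ENNReal.ofReal (p j θ) ∂(μ j) = 1)
    (hp_pos : ∀ j, ∀ᵐ θ ∂(μ j), 0 < p j θ)
    (φ : ∀ j, (Fin d → ℝ) → Θ j → ℝ)
    (hφ_meas : ∀ j, Measurable (fun q : (Fin d → ℝ) × Θ j => φ j q.1 q.2))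
    (hφ_bdd : ∀ j x θ, |φ j x θ| ≤ Real.sqrt 2)
    (γ : ∀ j, Θ j → ℝ) (hγ_meas : ∀ j, Measurable (γ j))
    (hI : ∀ j, Integrable (fun θ => γ j θ ^ 2 / p j θ) (μ j))
    (hIR : (∑ j, ∫ θ, γ j θ ^ 2 / p j θ ∂(μ j)) ≤ R ^ 2)
    (f : ∀ j, (Fin d → ℝ) → ℝ)
    (hf : ∀ j x, f j x = ∫ θ, γ j θ * φ j x θ ∂(μ j))
    (x : ℕ → Fin d → ℝ) (y : ℕ → ℝ)
    (hy : ∀ t ∈ Finset.Icc 1 T, |y t| ≤ Y) :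
    (1 / 2) * ∫ ω : ∀ j, Fin m → Θ j,
        (∑ t ∈ Finset.Icc 1 T,
          ((∑ jk : Fin N × Fin m,
              vaw 1 (fun s jk' => φ jk'.1 (x s) (ω jk'.1 jk'.2)) y t jk
                * φ jk.1 (x t) (ω jk.1 jk.2)) - y t) ^ 2)
        ∂(Measure.pi fun j =>
            Measure.pi fun _ : Fin m => (μ j).withDensity fun θ => ENNReal.ofReal (p j θ))
      ≤ (1 / 2) * ∑ t ∈ Finset.Icc 1 T, ((∑ j, f j (x t)) - y t) ^ 2
        + 4 * N * (R ^ 2 + Y ^ 2 * Real.log (T + 1)) * Real.sqrt T := by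
  have hbounds := Nat.ceil_sqrt_bounds hT
  rw [← hm] at hbounds
  have hsqrt : 1 ≤ √(T : ℝ) := Real.one_le_sqrt.2 (by exact_mod_cast hT)
  have hm_pos : (0 : ℝ) < m := by linarith
  have : Nonempty (Fin m) := Fin.pos_iff_nonempty.1 (by exact_mod_cast hm_pos)
  have hν : ∀ j, IsProbabilityMeasure ((μ j).withDensity fun θ => ENNReal.ofReal (p j θ)) :=
    fun j => ⟨by simp [withDensity_apply, hp_prob j]⟩
  have hloss := integral_vaw_loss_le (κ := Fin m)
    (fun j => memLp_div_withDensity_ofReal (hp_meas j) (hp_nonneg j) (hγ_meas j) (hI j))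
    (ψ := fun t j => φ j (x t)) (fun t j => (hφ_meas j).comp measurable_prodMk_left)
    (fun t j => hφ_bdd j (x t)) y T hy
  simp only [integral_div_mul_withDensity_ofReal (hp_meas _) (hp_nonneg _) (hp_pos _),
    integral_sq_div_withDensity_ofReal (hp_meas _) (hp_nonneg _), ← hf, Fintype.card_fin,
    Real.sq_sqrt zero_le_two] at hloss
  set A := ∑ j, ∫ θ, γ j θ ^ 2 / p j θ ∂(μ j) with hA
  have hA_le : A ≤ N * R ^ 2 := by
    rcases Nat.eq_zero_or_pos N with rfl | hN
    · simp [hA]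
    · have : (1 : ℝ) ≤ N := by exact_mod_cast hN
      nlinarith [sq_nonneg R]
  have hA_nonneg : 0 ≤ A := Finset.sum_nonneg fun j _ =>
    integral_nonneg fun θ => div_nonneg (sq_nonneg _) (hp_nonneg j θ)
  have hT_sq : √(T : ℝ) * √T = T := Real.mul_self_sqrt (Nat.cast_nonneg T)
  have hMC : (T * 2 + 1) * A / m ≤ 3 * √T * (N * R ^ 2) := by
    rw [div_le_iff₀ hm_pos]
    have hTm : (T : ℝ) * 2 + 1 ≤ 3 * √T * m := by nlinarith
    calc (T * 2 + 1) * A ≤ 3 * √T * m * A := mul_le_mul_of_nonneg_right hTm hA_nonneg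
      _ ≤ 3 * √T * m * (N * R ^ 2) := mul_le_mul_of_nonneg_left hA_le (by positivity)
      _ = _ := by ring
  have hlog_nonneg : 0 ≤ Real.log (T + 1) :=
    Real.log_nonneg (by linarith [Nat.cast_nonneg (α := ℝ) T])
  have hlog : m * Real.log (1 + 2 * T) ≤ 2 * √T * (2 * Real.log (T + 1)) :=
    mul_le_mul hbounds.2 (Real.log_one_add_two_mul_le (Nat.cast_nonneg T))
      (Real.log_nonneg (by linarith [Nat.cast_nonneg (α := ℝ) T])) (by positivity)
  have hcap : Y ^ 2 * (N * m * Real.log (1 + 2 * T))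
      ≤ Y ^ 2 * N * (2 * √T * (2 * Real.log (T + 1))) := by
    calc _ = Y ^ 2 * N * (m * Real.log (1 + 2 * T)) := by ring
      _ ≤ _ := mul_le_mul_of_nonneg_left hlog (by positivity)
  have hslack : 0 ≤ √T * (N * R ^ 2) := by positivity
  have hslack' : 0 ≤ Y ^ 2 * N * √T * Real.log (T + 1) := by positivity
  linarith
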